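/- arXiv:1710.02892 — 2 statements merged into one kernel-verified Lean document; each statement's English description precedes it below -/
import Mathlib

section
/- Let k be a field, V a finite-dimensional k-vector space of dimension at least 1, and S an affine scheme over k. Then the canonical pullback map Γ(S, O_S) → Γ(ℙ(V) × S, O) along the projection pr₂ : ℙ(V) × S → S is bijective; in other words, every regular function on ℙ(V) × S is pulled back from S. -/
/-!
STATEMENT 0: Let `k` be a field, `V` a finite-dimensional `k`-vector space of dimension
at least 1, and `S` an affine scheme over `k`.  Then the canonical pullback map
`Γ(S, O_S) → Γ(ℙ(V) × S, O)` along the projection `pr₂ : ℙ(V) × S → S` is bijective.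

Here `ℙ(V)` is modelled as `Proj` of the symmetric algebra of `V`, i.e. `Proj` of the
polynomial ring on a basis of `V` with its standard grading, and `ℙ(V) × S` is the fiber
product `ℙ(V) ×_{Spec k} S` in the category of schemes.
-/

open AlgebraicGeometry CategoryTheory TopologicalSpace Opposite Limits

attribute [local instance] MvPolynomial.gradedAlgebra

noncomputable section

namespace MvPolynomial

/-- A form of degree `n` divisible by the `n`-th power of a variable is a scalar multiple of it. -/
lemma IsHomogeneous.exists_eq_C_mul_X_pow_of_dvd {σ R : Type*} [CommRing R] [IsDomain R]
    {a : MvPolynomial σ R} {i : σ} {n : ℕ} (ha : a.IsHomogeneous n) (h : X i ^ n ∣ a) :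
    ∃ c : R, a = C c * X i ^ n := by
  obtain ⟨q, rfl⟩ := h
  by_cases hq : q = 0
  · exact ⟨0, by simp [hq]⟩
  have hX : (X i ^ n : MvPolynomial σ R) ≠ 0 := pow_ne_zero _ (X_ne_zero i)
  have hdeg := ha.totalDegree (mul_ne_zero hX hq)
  rw [totalDegree_mul_of_isDomain hX hq, totalDegree_X_pow, Nat.add_eq_left,
    totalDegree_eq_zero_iff_eq_C] at hdeg
  exact ⟨_, by rw [mul_comm, ← hdeg]⟩

/-- In one variable every form of degree `n` is divisible by the `n`-th power of the variable. -/
lemma IsHomogeneous.X_pow_dvd_of_subsingleton {σ R : Type*} [Subsingleton σ] [CommSemiring R]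
    {a : MvPolynomial σ R} {n : ℕ} (ha : a.IsHomogeneous n) (i : σ) : X i ^ n ∣ a := by
  rw [X_pow_eq_monomial, monomial_one_dvd_iff_modMonomial_eq_zero]
  ext d
  by_cases hd : Finsupp.single i n ≤ d
  · simp [coeff_modMonomial_of_le _ hd]
  · rw [coeff_modMonomial_of_not_le _ hd, coeff_zero]
    refine ha.coeff_eq_zero fun h ↦ hd ?_
    have : Unique σ := { default := i, uniq := fun _ ↦ Subsingleton.elim _ _ }
    rw [Finsupp.degree_eq_sum, Fintype.sum_unique] at h
    simpa [Finsupp.single_le_iff, Subsingleton.elim i default] using h.ge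

/-- Forms `a i` of degree `n i` such that the fractions `a i / X i ^ n i` agree are all given by
one and the same scalar. -/
lemma exists_forall_eq_C_mul_X_pow {σ R : Type*} [Nonempty σ] [CommRing R] [IsDomain R]
    (n : σ → ℕ) (a : σ → MvPolynomial σ R) (ha : ∀ i, (a i).IsHomogeneous (n i))
    (h : ∀ i j, a i * X j ^ n j = a j * X i ^ n i) :
    ∃ c : R, ∀ i, a i = C c * X i ^ n i := by
  obtain ⟨i⟩ := ‹Nonempty σ›
  have hdvd : X i ^ n i ∣ a i := by
    cases subsingleton_or_nontrivial σ
    · exact (ha i).X_pow_dvd_of_subsingleton i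
    · obtain ⟨j, hj⟩ := exists_ne i
      refine (X_prime (i := i)).pow_dvd_of_dvd_mul_right (n i) (b := X j ^ n j) ?_
        (h i j ▸ dvd_mul_left _ _)
      intro hij
      exact hj (X_dvd_X.mp ((X_prime (i := i)).dvd_of_dvd_pow hij)).symm
  obtain ⟨c, hc⟩ := (ha i).exists_eq_C_mul_X_pow_of_dvd hdvd
  refine ⟨c, fun j ↦ mul_right_cancel₀ (pow_ne_zero (n i) (X_ne_zero i)) ?_⟩
  rw [← h i j, hc]
  ring

lemma X_mem_homogeneousSubmodule {σ : Type*} (R : Type*) [CommSemiring R] (i : σ) :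
    X i ∈ homogeneousSubmodule σ R 1 :=
  isHomogeneous_X R i

end MvPolynomial

open HomogeneousLocalization in
/-- Compatible families of degree zero fractions on the standard charts of projective space are
constant. -/
lemma MvPolynomial.exists_forall_eq_fromZeroRingHom {σ R : Type*} [Nonempty σ] [CommRing R]
    [IsDomain R] (z : ∀ i : σ, Away (homogeneousSubmodule σ R) (X i))
    (h : ∀ i j, awayMap (homogeneousSubmodule σ R) (X_mem_homogeneousSubmodule R j) rfl (z i) =
      awayMap (homogeneousSubmodule σ R) (X_mem_homogeneousSubmodule R i) (mul_comm (X i) (X j)) (z j)) :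
    ∃ c : R, ∀ i, z i = fromZeroRingHom (homogeneousSubmodule σ R) _
      (algebraMap R (homogeneousSubmodule σ R 0) c) := by
  choose n a ha hz using fun i ↦ Away.mk_surjective _ (X_mem_homogeneousSubmodule R i) (z i)
  obtain ⟨c, hc⟩ := exists_forall_eq_C_mul_X_pow n a (fun i ↦ by simpa using ha i) fun i j ↦ by
    have hij := congr_arg HomogeneousLocalization.val (h i j)
    rw [← hz i, ← hz j, awayMap_mk, awayMap_mk, Away.val_mk, Away.val_mk,
      Localization.mk_eq_mk_iff, Localization.r_iff_exists] at hij
    obtain ⟨⟨_, m, rfl⟩, hm⟩ := hij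
    have hX (i : σ) (m : ℕ) : (X i ^ m : MvPolynomial σ R) ≠ 0 := pow_ne_zero _ (X_ne_zero i)
    refine mul_left_cancel₀ (mul_ne_zero (hX i (m + n j)) (hX j (m + n i))) ?_
    simp only [mul_pow] at hm
    linear_combination hm
  refine ⟨c, fun i ↦ ?_⟩
  rw [← hz i]
  ext
  refine Localization.mk_eq_mk_iff.mpr (Localization.r_iff_exists.mpr ⟨1, ?_⟩)
  simp [hc, MvPolynomial.algebraMap_eq, mul_comm]

namespace AlgebraicGeometry

universe u

/-- If global functions on a qcqs `X` over an affine base are those of the base, the same holds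
after flat affine base change. -/
lemma isIso_appTop_of_isPullback_of_flat {X Y S T : Scheme.{u}} {f : T ⟶ S} {g : Y ⟶ X}
    {iX : X ⟶ S} {iY : Y ⟶ T} (H : IsPullback g iY iX f) [IsAffine S] [IsAffine T] [CompactSpace X]
    [QuasiSeparatedSpace X] [Flat f] [IsIso iX.appTop] : IsIso iY.appTop := by
  have hY : (⊤ : Y.Opens) = g ⁻¹ᵁ ⊤ ⊓ iY ⁻¹ᵁ ⊤ := (inf_idem _).symm
  have h := (isIso_pushoutSection_iff H (US := ⊤) (UT := ⊤) (UX := ⊤) le_top le_top hY).mp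
    (isIso_pushoutSection_of_isQuasiSeparated_of_flat_right H _ _ _ (isAffineOpen_top S)
      (isAffineOpen_top T) isCompact_univ isQuasiSeparated_univ)
  have hX : iX.appLE ⊤ ⊤ le_top = iX.appTop := Scheme.Hom.appLE_eq_app ..
  have hY' : iY.appLE ⊤ ⊤ le_top = iY.appTop := Scheme.Hom.appLE_eq_app ..
  rw [← hY']
  exact h.isIso_inr_of_isIso (hX ▸ inferInstance)

namespace Proj

open MvPolynomial HomogeneousLocalization

variable (σ R : Type u) [CommRing R]

lemma irrelevant_homogeneousSubmodule_le_span_X :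
    (HomogeneousIdeal.irrelevant (homogeneousSubmodule σ R)).toIdeal ≤
      Ideal.span (Set.range (X : σ → MvPolynomial σ R)) := by
  intro p hp
  rw [← Set.image_univ, mem_ideal_span_X_image]
  intro m hm
  by_contra! h
  obtain rfl : m = 0 := by ext i; simpa using h i
  have h0 := congr_arg (coeff 0) ((HomogeneousIdeal.mem_irrelevant_iff _ _).mp hp)
  rw [GradedRing.proj_apply, ← DirectSum.Decomposition.decompose'_eq,
    decomposition.decompose'_apply, coeff_homogeneousComponent] at h0
  simp_all

/-- The cover of projective space by the standard charts. -/
def standardCover : (Proj (homogeneousSubmodule σ R)).OpenCover :=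
  (affineOpenCoverOfIrrelevantLESpan (homogeneousSubmodule σ R) X
    (X_mem_homogeneousSubmodule R) (fun _ ↦ one_pos)
    (irrelevant_homogeneousSubmodule_le_span_X σ R)).openCover

instance compactSpace_homogeneousSubmodule [Finite σ] :
    CompactSpace (Proj (homogeneousSubmodule σ R)) := by
  have : Finite (standardCover σ R).I₀ := ‹Finite σ›
  have hX : ∀ i, CompactSpace ((standardCover σ R).X i) := fun i : σ ↦
    inferInstanceAs (CompactSpace (Spec (.of (Away (homogeneousSubmodule σ R) (X i)))))
  exact (standardCover σ R).compactSpace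

variable {σ} in
/-- Restriction of a global function to the chart where `f` is invertible. -/
def evalAway {f : MvPolynomial σ R} {m : ℕ} (hf : f ∈ homogeneousSubmodule σ R m) (hm : 0 < m) :
    Γ(Proj (homogeneousSubmodule σ R), ⊤) ⟶ .of (Away (homogeneousSubmodule σ R) f) :=
  (awayι (homogeneousSubmodule σ R) f hf hm).appTop ≫ (Scheme.ΓSpecIso _).hom

variable {σ R} in
lemma evalAway_comp_awayMap {f g x : MvPolynomial σ R} {m n : ℕ} (hf : f ∈ homogeneousSubmodule σ R m)
    (hm : 0 < m) (hg : g ∈ homogeneousSubmodule σ R n) (hx : x = f * g) :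
    evalAway R hf hm ≫ CommRingCat.ofHom (awayMap (homogeneousSubmodule σ R) hg hx) =
      evalAway R (f := x) (hx ▸ SetLike.mul_mem_graded hf hg) (hm.trans_le (m.le_add_right n)) := by
  rw [evalAway, evalAway, ← SpecMap_awayMap_awayι _ hf hm hg hx, Scheme.Hom.comp_appTop,
    Category.assoc, Category.assoc, Scheme.ΓSpecIso_naturality]

/-- The structure morphism of projective space over `R`. -/
abbrev toSpecBase : Proj (homogeneousSubmodule σ R) ⟶ Spec (.of R) :=
  toSpecZero (homogeneousSubmodule σ R) ≫
    Spec.map (CommRingCat.ofHom (algebraMap R (homogeneousSubmodule σ R 0)))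

variable {σ R} in
lemma toSpecBase_appTop_comp_evalAway {f : MvPolynomial σ R} {m : ℕ}
    (hf : f ∈ homogeneousSubmodule σ R m) (hm : 0 < m) :
    (toSpecBase σ R).appTop ≫ evalAway R hf hm = (Scheme.ΓSpecIso _).hom ≫
      CommRingCat.ofHom ((fromZeroRingHom (homogeneousSubmodule σ R) (.powers f)).comp
        (algebraMap R (homogeneousSubmodule σ R 0))) := by
  rw [evalAway, ← Category.assoc, ← Scheme.Hom.comp_appTop, awayι_toSpecZero_assoc,
    ← Spec.map_comp, Scheme.ΓSpecIso_naturality]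
  rfl

/-- Over a domain, the global functions on projective space are the constants. -/
theorem bijective_toSpecBase_appTop [IsDomain R] [Nonempty σ] :
    Function.Bijective (toSpecBase σ R).appTop := by
  have evalAway_appTop (i : σ) (t) := ConcreteCategory.congr_hom
    (toSpecBase_appTop_comp_evalAway (X_mem_homogeneousSubmodule R i) one_pos) t
  have hiso := ConcreteCategory.bijective_of_isIso (Scheme.ΓSpecIso (.of R)).hom
  constructor
  · obtain ⟨i⟩ := ‹Nonempty σ›
    have hinj : Function.Injective
        (((fromZeroRingHom (homogeneousSubmodule σ R) (.powers (X i))).comp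
          (algebraMap R (homogeneousSubmodule σ R 0)))) := by
      intro a b hab
      have := congr_arg HomogeneousLocalization.val hab
      exact C_injective σ R (IsLocalization.injective (Localization.Away (X i : MvPolynomial σ R))
        (powers_le_nonZeroDivisors_of_noZeroDivisors (X_ne_zero i)) this)
    intro a b hab
    refine hiso.1 (hinj ?_)
    have := congr_arg (evalAway R (X_mem_homogeneousSubmodule R i) one_pos) hab
    exact (evalAway_appTop i a).symm.trans (this.trans (evalAway_appTop i b))
  · intro s
    obtain ⟨c, hc⟩ := exists_forall_eq_fromZeroRingHom
      (fun i : σ ↦ evalAway R (X_mem_homogeneousSubmodule R i) one_pos s) fun i j ↦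
        (ConcreteCategory.congr_hom (evalAway_comp_awayMap (X_mem_homogeneousSubmodule R i) one_pos
          (X_mem_homogeneousSubmodule R j) rfl) s).trans
        (ConcreteCategory.congr_hom (evalAway_comp_awayMap (X_mem_homogeneousSubmodule R j) one_pos
          (X_mem_homogeneousSubmodule R i) (mul_comm (X i) (X j))) s).symm
    obtain ⟨t, rfl⟩ := hiso.2 c
    refine ⟨t, (standardCover σ R).ext_elem _ _ fun i ↦ ?_⟩
    refine (ConcreteCategory.bijective_of_isIso (Scheme.ΓSpecIso _).hom).1 ?_
    exact (evalAway_appTop i t).trans (hc i).symm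

end Proj

end AlgebraicGeometry

variable (k : Type) [Field k] (V : Type) [AddCommGroup V] [Module k V] [FiniteDimensional k V]

/-- The index type of a chosen basis of `V`. -/
abbrev PCoord := Module.Free.ChooseBasisIndex k V

/-- The symmetric algebra of `V`, modelled as the polynomial ring on a basis of `V`,
with its standard grading by (total) degree. -/
abbrev symAlgGrading := MvPolynomial.homogeneousSubmodule (PCoord k V) k

/-- The projective space `ℙ(V)`, as `Proj` of the symmetric algebra of `V`. -/
def ProjSpace : Scheme := Proj (symAlgGrading k V)

/-- The structure morphism `ℙ(V) ⟶ Spec k`. -/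
def ProjSpace.toSpec : ProjSpace k V ⟶ Spec (CommRingCat.of k) :=
  Proj.toSpecZero (symAlgGrading k V) ≫
    Spec.map (CommRingCat.ofHom (algebraMap k (symAlgGrading k V 0)))

/-- Every regular function on `ℙ(V) × S` is pulled back from `S`: the pullback map on
global sections along the second projection `pr₂ : ℙ(V) ×_{Spec k} S ⟶ S` is bijective. -/
theorem bijective_appTop_snd_projSpace_prod
    (hdim : 0 < Module.finrank k V)
    (S : Scheme) [IsAffine S] (g : S ⟶ Spec (CommRingCat.of k)) :
    Function.Bijective ((pullback.snd (ProjSpace.toSpec k V) g).appTop) := by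
  have : Nontrivial V := Module.nontrivial_of_finrank_pos hdim
  have : CompactSpace (ProjSpace k V) := inferInstanceAs (CompactSpace (Proj (symAlgGrading k V)))
  have : QuasiSeparatedSpace (ProjSpace k V) :=
    inferInstanceAs (QuasiSeparatedSpace (Proj (symAlgGrading k V)))
  have : IsIso (ProjSpace.toSpec k V).appTop :=
    (ConcreteCategory.isIso_iff_bijective _).mpr (Proj.bijective_toSpecBase_appTop (PCoord k V) k)
  exact (ConcreteCategory.isIso_iff_bijective _).mp
    (isIso_appTop_of_isPullback_of_flat (IsPullback.of_hasPullback (ProjSpace.toSpec k V) g))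

end
end

section
/- Let k be a field, V a finite-dimensional k-vector space, and U ⊆ ℙ(V) an open subset whose closed complement Z = ℙ(V) ∖ U has codimension at least two. Then for every affine scheme S over k, the restriction map Γ(ℙ(V) × S, O) → Γ(U × S, O) on regular functions is bijective; in particular, every regular function on U × S extends uniquely to ℙ(V) × S. -/
/-!
STATEMENT 1: Let `k` be a field, `V` a finite-dimensional `k`-vector space, and
`U ⊆ ℙ(V)` an open subset whose closed complement `Z = ℙ(V) ∖ U` has codimension at
least two (i.e. `dim Z + 2 ≤ dim ℙ(V)` for the topological Krull dimension; the empty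
set, of dimension `⊥`, satisfies this for free).  Then for every affine scheme `S` over
`k`, the restriction map `Γ(ℙ(V) × S, O) → Γ(U × S, O)` is bijective.

Here `ℙ(V)` is modelled as `Proj` of the symmetric algebra of `V` (the polynomial ring
on a basis of `V` with its standard grading), `ℙ(V) × S` is the fiber product
`ℙ(V) ×_{Spec k} S`, and `U × S` is the open subset `pr₁⁻¹(U)` of `ℙ(V) × S`.
-/

open AlgebraicGeometry CategoryTheory TopologicalSpace Opposite Limits

attribute [local instance] MvPolynomial.gradedAlgebra

noncomputable section

variable (k : Type) [Field k] (V : Type) [AddCommGroup V] [Module k V] [FiniteDimensional k V]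

universe u

/-- Every maximal ideal of a polynomial ring in `n` variables over a field has height `n`. -/
lemma MvPolynomial.height_eq_card_of_isMaximal {k ι : Type*} [Field k] [Finite ι]
    (M : Ideal (MvPolynomial ι k)) [M.IsMaximal] : M.height = Nat.card ι := by
  induction ι using Finite.induction_empty_option with
  | of_equiv e H =>
    let f := (renameEquiv k e).toRingEquiv
    have : (M.map f.symm).IsMaximal := Ideal.map_isMaximal_of_equiv f.symm
    rw [← f.symm.height_map M, H, Nat.card_congr e]
  | h_empty =>
    have : (M.map (isEmptyRingEquiv k PEmpty)).IsMaximal :=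
      Ideal.map_isMaximal_of_equiv (isEmptyRingEquiv k PEmpty)
    rw [← (isEmptyRingEquiv k PEmpty).height_map M,
      (M.map (isEmptyRingEquiv k PEmpty)).eq_bot_of_prime]
    simp
  | @h_option α _ IH =>
    let f := (optionEquivLeft k α).toRingEquiv
    have : (M.map f).IsMaximal := Ideal.map_isMaximal_of_equiv f
    have : ((M.map f).under (MvPolynomial α k)).IsMaximal :=
      Polynomial.isMaximal_comap_C_of_isJacobsonRing (M.map f)
    have : (M.map f).LiesOver ((M.map f).under (MvPolynomial α k)) := ⟨rfl⟩
    rw [← f.height_map M,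
      Polynomial.height_eq_height_add_one ((M.map f).under (MvPolynomial α k)) (M.map f), IH]
    simp

lemma MvPolynomial.ringKrullDim_quotient_span_prime_add_one {k ι : Type*} [Field k] [Finite ι]
    {p : MvPolynomial ι k} (hp : Prime p) :
    ringKrullDim (MvPolynomial ι k ⧸ Ideal.span {p}) + 1 = Nat.card ι := by
  obtain ⟨M, hM, hpM⟩ := Ideal.exists_le_maximal (Ideal.span {p})
    (by simpa [Ideal.span_singleton_eq_top] using hp.not_isUnit)
  have hdim : ringKrullDim (MvPolynomial ι k) = Nat.card ι := by simp
  rw [← hdim]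
  refine Module.ringKrullDim_quotient_add_one_of_mem_nonZeroDivisors (p := M)
    (mem_nonZeroDivisors_of_ne_zero hp.ne_zero) ?_ (hpM (Ideal.mem_span_singleton_self p))
  rw [hdim, height_eq_card_of_isMaximal]
  norm_cast

/-- A space covered by open subspaces of dimension at most `n` has dimension at most `n`. -/
lemma topologicalKrullDim_le_of_isOpenEmbedding {X : Type*} [TopologicalSpace X] {ι : Type*}
    {Y : ι → Type*} [∀ i, TopologicalSpace (Y i)] {f : ∀ i, Y i → X}
    (hf : ∀ i, Topology.IsOpenEmbedding (f i)) (hcov : ∀ x, ∃ i, x ∈ Set.range (f i))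
    {n : WithBot ℕ∞} (hn : ∀ i, topologicalKrullDim (Y i) ≤ n) :
    topologicalKrullDim X ≤ n := by
  rw [topologicalKrullDim, Order.krullDim_eq_iSup_coheight]
  refine iSup_le fun Z ↦ ?_
  obtain ⟨x, hx⟩ := Z.2.nonempty
  obtain ⟨i, y, rfl⟩ := hcov x
  let Z' := IrreducibleCloseds.orderIsoOfIsOpenEmbedding (f i) (hf i) |>.symm
    ⟨Z, ⟨y, hx⟩⟩
  have hZ : Z = IrreducibleCloseds.map (f i) (hf i).continuous Z' :=
    congr_arg Subtype.val
      ((IrreducibleCloseds.orderIsoOfIsOpenEmbedding (f i) (hf i)).apply_symm_apply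
        ⟨Z, ⟨y, hx⟩⟩).symm
  rw [hZ, (hf i).coheight_map]
  exact (Order.coheight_le_krullDim Z').trans (hn i)

/-- A rational function on an affine open `W` with factorial coordinate ring is regular on `W` as
soon as it is regular on an open set containing all points of `W` given by prime elements. -/
lemma AlgebraicGeometry.IsAffineOpen.exists_extension_of_uniqueFactorizationMonoid
    {X : Scheme.{u}} [IsIntegral X] {U W : X.Opens} [Nonempty U] [Nonempty W]
    (hW : IsAffineOpen W) [UniqueFactorizationMonoid Γ(X, W)]
    (h : ∀ (P : Spec Γ(X, W)) (p : Γ(X, W)), Prime p → P.asIdeal = Ideal.span {p} →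
      hW.fromSpec P ∈ U) (s : Γ(X, U)) :
    ∃ t : Γ(X, W), X.germToFunctionField W t = X.germToFunctionField U s := by
  have := functionField_isFractionRing_of_isAffineOpen X W hW
  obtain ⟨a, b, hab, hs⟩ := IsFractionRing.exists_reduced_fraction Γ(X, W)
    (X.germToFunctionField U s)
  have hs' : X.germToFunctionField W a =
      X.germToFunctionField U s * X.germToFunctionField W b :=
    IsLocalization.mk'_eq_iff_eq_mul.mp hs
  suffices hb : IsUnit (b : Γ(X, W)) by
    obtain ⟨c, hc⟩ := hb.exists_right_inv
    refine ⟨a * c, ?_⟩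
    rw [map_mul, hs', mul_assoc, ← map_mul, hc, map_one, mul_one]
  by_contra hb
  obtain ⟨p, hp, hpb⟩ := WfDvdMonoid.exists_irreducible_factor hb (nonZeroDivisors.ne_zero b.2)
  replace hp := hp.prime
  let P : Spec Γ(X, W) := ⟨Ideal.span {p}, (Ideal.span_singleton_prime hp.ne_zero).mpr hp⟩
  have hPW : hW.fromSpec P ∈ W := by
    rw [← SetLike.mem_coe, ← hW.range_fromSpec]
    exact ⟨P, rfl⟩
  obtain ⟨f, hfU, hf⟩ := hW.exists_basicOpen_le ⟨_, h P p hp rfl⟩ hPW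
  have : Nonempty (X.basicOpen f) := ⟨⟨_, hf⟩⟩
  have := hW.isLocalization_basicOpen f
  obtain ⟨⟨c, _, n, rfl⟩, hc⟩ := IsLocalization.surj (Submonoid.powers f)
    (X.presheaf.map (homOfLE hfU).op s)
  have hdvd : (b : Γ(X, W)) ∣ a * f ^ n := by
    refine ⟨c, X.germToFunctionField_injective W ?_⟩
    have hc' : X.germToFunctionField U s * X.germToFunctionField W (f ^ n) =
        X.germToFunctionField W c := by
      have := congr_arg (X.germToFunctionField (X.basicOpen f)) hc
      rw [map_mul] at this
      erw [X.presheaf.germ_res_apply, X.presheaf.germ_res_apply, X.presheaf.germ_res_apply] at this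
      exact this
    rw [map_mul, map_mul, hs', ← hc']
    ring
  have hpf : p ∣ f := hp.dvd_of_dvd_pow (hpb.trans (hab.symm.dvd_of_dvd_mul_left hdvd))
  have hfP : P ∈ hW.fromSpec ⁻¹ᵁ X.basicOpen f := hf
  rw [hW.fromSpec_preimage_basicOpen f] at hfP
  exact hfP (Ideal.mem_span_singleton.mpr hpf)

/-- Regular functions extend from an open `U` of an integral scheme covered by factorial affine
opens, provided `U` contains all points given by prime elements. -/
lemma AlgebraicGeometry.Scheme.bijective_restriction_of_uniqueFactorizationMonoid
    {X : Scheme.{u}} [IsIntegral X] {U : X.Opens} [Nonempty U] {ι : Type*} (W : ι → X.Opens)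
    [∀ i, Nonempty (W i)] (hW : ∀ i, IsAffineOpen (W i)) (hcov : ⨆ i, W i = ⊤)
    (hUFD : ∀ i, UniqueFactorizationMonoid Γ(X, W i))
    (h : ∀ (i) (P : Spec Γ(X, W i)) (p : Γ(X, W i)), Prime p → P.asIdeal = Ideal.span {p} →
      (hW i).fromSpec P ∈ U) :
    Function.Bijective (X.presheaf.map (homOfLE (le_top : U ≤ ⊤)).op) := by
  refine ⟨map_injective_of_isIntegral X _, fun s ↦ ?_⟩
  choose t ht using fun i ↦ (hW i).exists_extension_of_uniqueFactorizationMonoid (h i) s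
  have hη (V : X.Opens) [Nonempty V] : genericPoint X ∈ V :=
    ((genericPoint_spec X).mem_open_set_iff V.isOpen).mpr (by simpa using ‹Nonempty V›)
  obtain ⟨g, hg, -⟩ := X.sheaf.existsUnique_gluing' W ⊤ (fun i ↦ homOfLE le_top) hcov.ge t
    fun i j ↦ by
      let W' : X.Opens := W i ⊓ W j
      have : Nonempty W' := ⟨⟨_, hη (W i), hη (W j)⟩⟩
      apply X.germToFunctionField_injective W'
      erw [X.presheaf.germ_res_apply, X.presheaf.germ_res_apply]
      exact (ht i).trans (ht j).symm
  refine ⟨g, X.germToFunctionField_injective U ?_⟩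
  obtain ⟨i, -⟩ := Opens.mem_iSup.mp (hcov.ge (Opens.mem_top (genericPoint X)))
  have hi := (congr_arg (X.germToFunctionField (W i)) (hg i)).trans (ht i)
  erw [X.presheaf.germ_res_apply] at hi ⊢
  exact hi

/-- Bijectivity of the restriction map to an open subset is stable under flat affine base change. -/
lemma AlgebraicGeometry.Scheme.bijective_restriction_pullback_of_flat
    {X S T : Scheme.{u}} [IsNoetherian X] [IsAffine S] [IsAffine T] (π : X ⟶ S) (g : T ⟶ S) [Flat g]
    (U : X.Opens)
    (h : Function.Bijective (X.presheaf.map (homOfLE (le_top : U ≤ ⊤)).op)) :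
    Function.Bijective ((pullback π g).presheaf.map
      (homOfLE (le_top : pullback.fst π g ⁻¹ᵁ U ≤ ⊤)).op) := by
  have H := IsPullback.of_hasPullback π g
  have hqc (W : X.Opens) : IsCompact (W : Set X) := NoetherianSpace.isCompact _
  have hqs (W : X.Opens) : IsQuasiSeparated (W : Set X) :=
    IsQuasiSeparated.of_quasiSeparatedSpace _
  have key (W : X.Opens) := (isIso_pushoutSection_iff H (US := ⊤) (UT := ⊤) (UX := W)
    (UY := pullback.fst π g ⁻¹ᵁ W) le_top le_top (by simp)).mp
    (isIso_pushoutSection_of_isQuasiSeparated_of_flat_right H _ _ _ (isAffineOpen_top S)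
      (isAffineOpen_top T) (hqc W) (hqs W))
  have hX : IsIso (X.presheaf.map (homOfLE (le_top : U ≤ ⊤)).op) :=
    (ConcreteCategory.isIso_iff_bijective _).mpr h
  let e := asIso (X.presheaf.map (homOfLE (le_top : U ≤ ⊤)).op)
  have key' := (key ⊤).of_iso (.refl _) e (.refl _) (.refl _) (f' := π.appLE ⊤ U le_top)
    (g' := g.appLE ⊤ ⊤ le_top) (inl' := e.inv ≫ (pullback.fst π g).appLE ⊤ ⊤ le_top)
    (inr' := (pullback.snd π g).appLE ⊤ ⊤ le_top)
    ((Scheme.Hom.appLE_map ..).trans (Category.id_comp _).symm) (by simp) (by simp) (by simp)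
  have hr : (pullback π g).presheaf.map (homOfLE (le_top : pullback.fst π g ⁻¹ᵁ U ≤ ⊤)).op =
      (key'.isoIsPushout _ _ (key U)).hom := by
    refine key'.hom_ext ?_ ?_
    · rw [IsPushout.inl_isoIsPushout_hom, Category.assoc, Iso.inv_comp_eq]
      exact (Scheme.Hom.appLE_map ..).trans (Scheme.Hom.map_appLE ..).symm
    · rw [IsPushout.inr_isoIsPushout_hom]
      exact Scheme.Hom.appLE_map ..
  rw [hr]
  exact ConcreteCategory.bijective_of_isIso _

section
open MvPolynomial
variable {k ι : Type*} [Field k]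

lemma MvPolynomial.IsHomogeneous.eval₂Hom_smul {R S σ : Type*} [CommSemiring R] [CommSemiring S]
    {a : MvPolynomial σ R} {n : ℕ} (ha : a.IsHomogeneous n) (f : R →+* S) (c : S) (g : σ → S) :
    eval₂Hom f (fun i ↦ c * g i) a = c ^ n * eval₂Hom f g a := by
  simp only [coe_eval₂Hom, eval₂_eq, Finset.mul_sum]
  refine Finset.sum_congr rfl fun d hd ↦ ?_
  have hdeg : ∑ i ∈ d.support, d i = n := by
    simpa [Finsupp.weight_apply, Finsupp.sum] using ha (mem_support_iff.mp hd)
  simp only [mul_pow, Finset.prod_mul_distrib, Finset.prod_pow_eq_pow_sum, hdeg]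
  ring

variable (k) in
open Classical in
/-- Setting the variable `X i` to `1`. -/
noncomputable def dehomogenize (i : ι) : MvPolynomial ι k →+* MvPolynomial {j // j ≠ i} k :=
  eval₂Hom C fun j ↦ if h : j = i then 1 else X ⟨j, h⟩

variable (k) in
lemma dehomogenize_X_self (i : ι) : dehomogenize k i (X i) = 1 := by
  simp [dehomogenize]

lemma X_mem_homogeneousSubmodule (i : ι) : X i ∈ homogeneousSubmodule ι k 1 :=
  isHomogeneous_X k i

variable (k) in
/-- Evaluation at the affine coordinates `X j / X i` of the chart `X i ≠ 0`. -/
noncomputable def toAwayX (i : ι) :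
    MvPolynomial {j // j ≠ i} k →+* HomogeneousLocalization.Away (homogeneousSubmodule ι k) (X i) :=
  eval₂Hom ((HomogeneousLocalization.fromZeroRingHom _ _).comp
      (algebraMap k (homogeneousSubmodule ι k 0)))
    fun j ↦ .mk _ (X_mem_homogeneousSubmodule i) 1 (X j) (X_mem_homogeneousSubmodule j.1)

variable (k) in
/-- Setting `X i` to `1` in a fraction whose denominator is a power of `X i`. -/
noncomputable def ofAwayX (i : ι) :
    HomogeneousLocalization.Away (homogeneousSubmodule ι k) (X i) →+* MvPolynomial {j // j ≠ i} k :=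
  (IsLocalization.Away.lift (S := Localization.Away (X i : MvPolynomial ι k)) (X i)
    (g := dehomogenize k i) (by rw [dehomogenize_X_self]; exact isUnit_one)).comp
    (algebraMap _ _)

lemma ofAwayX_mk (i : ι) (n : ℕ) (a : MvPolynomial ι k)
    (ha : a ∈ homogeneousSubmodule ι k (n • 1)) :
    ofAwayX k i (.mk _ (X_mem_homogeneousSubmodule i) n a ha) = dehomogenize k i a := by
  have hu : IsUnit (dehomogenize k i (X i)) := by rw [dehomogenize_X_self]; exact isUnit_one
  simp only [ofAwayX, RingHom.comp_apply, HomogeneousLocalization.algebraMap_apply,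
    HomogeneousLocalization.Away.val_mk]
  have h : (Localization.mk a ⟨X i ^ n, Submonoid.pow_mem _ (Submonoid.mem_powers _) n⟩ :
      Localization.Away (X i : MvPolynomial ι k)) *
      algebraMap (MvPolynomial ι k) _ (X i ^ n) = algebraMap _ _ a := by
    rw [Localization.mk_eq_mk', IsLocalization.mk'_spec_mk]
  simpa [dehomogenize_X_self] using congr_arg (IsLocalization.Away.lift (X i) hu) h

lemma toAwayX_C (i : ι) (c : k) : toAwayX k i (C c) =
    .mk _ (X_mem_homogeneousSubmodule i) 0 (C c) (by simp) := by
  ext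
  simp only [toAwayX, eval₂Hom_C, HomogeneousLocalization.Away.val_mk, pow_zero]
  rfl

lemma ofAwayX_comp_toAwayX (i : ι) : (ofAwayX k i).comp (toAwayX k i) = RingHom.id _ := by
  refine MvPolynomial.ringHom_ext (fun c ↦ ?_) fun j ↦ ?_
  · rw [RingHom.comp_apply, toAwayX_C, ofAwayX_mk]
    simp [dehomogenize]
  · simp only [RingHom.comp_apply, toAwayX, eval₂Hom_X', ofAwayX_mk]
    simp [dehomogenize, j.2]

lemma pow_mul_val_toAwayX_dehomogenize (i : ι) {n : ℕ} {a : MvPolynomial ι k}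
    (ha : a.IsHomogeneous n) :
    algebraMap (MvPolynomial ι k) (Localization.Away (X i : MvPolynomial ι k)) (X i) ^ n *
      (toAwayX k i (dehomogenize k i a)).val = algebraMap _ _ a := by
  let θ : MvPolynomial ι k →+* Localization.Away (X i : MvPolynomial ι k) :=
    ((algebraMap _ _).comp (toAwayX k i)).comp (dehomogenize k i)
  have h₁ : θ = eval₂Hom (θ.comp C) (fun j ↦ θ (X j)) :=
    MvPolynomial.ringHom_ext (by simp) (by simp)
  have h₂ : algebraMap (MvPolynomial ι k) (Localization.Away (X i : MvPolynomial ι k)) =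
      eval₂Hom (θ.comp C) (fun j ↦ algebraMap (MvPolynomial ι k) _ (X i) * θ (X j)) := by
    refine MvPolynomial.ringHom_ext (fun c ↦ ?_) fun j ↦ ?_
    · simp only [θ, eval₂Hom_C, RingHom.comp_apply, dehomogenize, toAwayX_C,
        HomogeneousLocalization.algebraMap_apply, HomogeneousLocalization.Away.val_mk, pow_zero]
      exact (Localization.mk_one_eq_algebraMap _).symm
    · rw [eval₂Hom_X']
      by_cases hj : j = i
      · subst hj
        simp [θ, dehomogenize_X_self]
      · simp [θ, dehomogenize, toAwayX, hj, HomogeneousLocalization.Away.val_mk]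
        rw [Localization.mk_eq_mk', IsLocalization.mk'_spec'_mk]
  rw [h₂, ha.eval₂Hom_smul, ← h₁, ← h₂]
  rfl

variable (k) in
/-- The coordinate ring of the chart `X i ≠ 0` of projective space is a polynomial ring. -/
noncomputable def awayXEquiv (i : ι) :
    MvPolynomial {j // j ≠ i} k ≃+* HomogeneousLocalization.Away (homogeneousSubmodule ι k) (X i) :=
  RingEquiv.ofRingHom (toAwayX k i) (ofAwayX k i) (by
    ext z
    obtain ⟨n, a, ha, rfl⟩ :=
      HomogeneousLocalization.Away.mk_surjective _ (X_mem_homogeneousSubmodule i) z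
    have ha' : a.IsHomogeneous n := by simpa using ha
    rw [RingHom.comp_apply, ofAwayX_mk, RingHom.id_apply, HomogeneousLocalization.Away.val_mk,
      Localization.mk_eq_mk', IsLocalization.eq_mk'_iff_mul_eq,
      ← pow_mul_val_toAwayX_dehomogenize i ha', map_pow, mul_comm]) (ofAwayX_comp_toAwayX i)
end

section
open MvPolynomial
variable (k ι : Type) [Field k]

/-- The chart `X i ≠ 0` of projective space. -/
noncomputable def projChart (i : ι) : (Proj (homogeneousSubmodule ι k)).Opens :=
  Proj.basicOpen (homogeneousSubmodule ι k) (X i)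

lemma iSup_projChart : ⨆ i, projChart k ι i = ⊤ := by
  refine Proj.iSup_basicOpen_eq_top' _ (fun i ↦ X i) (fun i ↦ ⟨1, X_mem_homogeneousSubmodule i⟩)
    (eq_top_iff.mpr fun p _ ↦ ?_)
  induction p using MvPolynomial.induction_on with
  | C a =>
    exact Subalgebra.algebraMap_mem _ (⟨C a, isHomogeneous_C _ a⟩ : homogeneousSubmodule ι k 0)
  | add p q hp hq => exact add_mem (hp trivial) (hq trivial)
  | mul_X p i hp => exact mul_mem (hp trivial) (Algebra.subset_adjoin ⟨i, rfl⟩)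

variable {ι}

lemma isAffineOpen_projChart (i : ι) : IsAffineOpen (projChart k ι i) :=
  Proj.isAffineOpen_basicOpen _ _ (X_mem_homogeneousSubmodule i) one_pos

/-- The coordinate ring of a chart of projective space is a polynomial ring. -/
noncomputable def projChartEquiv (i : ι) :
    MvPolynomial {j // j ≠ i} k ≃+* Γ(Proj (homogeneousSubmodule ι k), projChart k ι i) :=
  (awayXEquiv k i).trans
    (Proj.basicOpenIsoAway _ _ (X_mem_homogeneousSubmodule i) one_pos).commRingCatIsoToRingEquiv

instance (i : ι) : IsDomain Γ(Proj (homogeneousSubmodule ι k), projChart k ι i) :=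
  (projChartEquiv k i).symm.toMulEquiv.isDomain _

instance (i : ι) : UniqueFactorizationMonoid Γ(Proj (homogeneousSubmodule ι k), projChart k ι i) :=
  (projChartEquiv k i).toMulEquiv.uniqueFactorizationMonoid inferInstance

instance [Nonempty ι] : IrreducibleSpace (Proj (homogeneousSubmodule ι k)) := by
  let i := Classical.arbitrary ι
  let η : ProjectiveSpectrum (homogeneousSubmodule ι k) :=
    ⟨⊥, by simpa using Ideal.isPrime_bot, fun h ↦ X_ne_zero (R := k) i 
      (h (HomogeneousIdeal.mem_irrelevant_of_mem _ one_pos (X_mem_homogeneousSubmodule i)))⟩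
  have h : closure {η} = Set.univ := Set.eq_univ_of_forall fun x ↦
    (ProjectiveSpectrum.le_iff_mem_closure _ η x).mp
      (bot_le : (⊥ : HomogeneousIdeal _) ≤ x.asHomogeneousIdeal)
  have := isIrreducible_singleton (x := η) |>.closure
  rw [h] at this
  exact (irreducibleSpace_def _).mpr this

instance [Nonempty ι] : IsIntegral (Proj (homogeneousSubmodule ι k)) := by
  have : IsReduced (Proj (homogeneousSubmodule ι k)) := by
    have (i : (Proj.affineOpenCover (homogeneousSubmodule ι k)).openCover.I₀) :
        IsReduced ((Proj.affineOpenCover (homogeneousSubmodule ι k)).openCover.X i) := by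
      let A := HomogeneousLocalization.Away (homogeneousSubmodule ι k) (i.2 : MvPolynomial ι k)
      have : _root_.IsReduced A :=
        isReduced_of_injective (algebraMap _ (Localization.Away (i.2 : MvPolynomial ι k)))
          (HomogeneousLocalization.val_injective _)
      exact inferInstanceAs (IsReduced (Spec (.of A)))
    exact .of_openCover _ (Proj.affineOpenCover (homogeneousSubmodule ι k)).openCover
  exact isIntegral_of_irreducibleSpace_of_isReduced _

instance [Finite ι] : IsNoetherian (Proj (homogeneousSubmodule ι k)) :=
  (isNoetherian_iff_of_finite_iSup_eq_top
    (S := fun i ↦ ⟨projChart k ι i, isAffineOpen_projChart k i⟩) (iSup_projChart k ι)).mpr fun i ↦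
      isNoetherianRing_of_ringEquiv _ (projChartEquiv k i)

lemma topologicalKrullDim_proj_le [Finite ι] (i : ι) :
    topologicalKrullDim (Proj (homogeneousSubmodule ι k)) ≤ Nat.card {j // j ≠ i} := by
  refine topologicalKrullDim_le_of_isOpenEmbedding
    (f := fun i ↦ (isAffineOpen_projChart k i).fromSpec)
    (fun i ↦ (isAffineOpen_projChart k i).fromSpec.isOpenEmbedding) (fun x ↦ ?_) fun j ↦ ?_
  · simpa using (iSup_projChart k ι).ge (Opens.mem_top x)
  · refine (PrimeSpectrum.topologicalKrullDim_eq_ringKrullDim _).trans_le ?_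
    rw [← ringKrullDim_eq_of_ringEquiv (projChartEquiv k j),
      MvPolynomial.ringKrullDim_of_isNoetherianRing, ringKrullDim_eq_zero_of_field, zero_add]
    cases nonempty_fintype ι
    classical
    simp

/-- An open subset with complement of codimension at least two contains every point of a chart
given by a prime element. -/
lemma mem_of_codim_two [Finite ι] {U : (Proj (homogeneousSubmodule ι k)).Opens}
    (hU : topologicalKrullDim ((U : Set (Proj (homogeneousSubmodule ι k)))ᶜ : Set _) + 2 ≤
      topologicalKrullDim (Proj (homogeneousSubmodule ι k))) (i : ι)
    (P : Spec Γ(Proj (homogeneousSubmodule ι k), projChart k ι i)) (p) (hp : Prime p)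
    (hP : P.asIdeal = Ideal.span {p}) : (isAffineOpen_projChart k i).fromSpec P ∈ U := by
  by_contra hPU
  set e := projChartEquiv k i
  let φ := (Ideal.Quotient.mk (Ideal.span {e.symm p})).comp e.symm.toRingHom
  have hφ : Function.Surjective φ := Ideal.Quotient.mk_surjective.comp e.symm.surjective
  let f := (isAffineOpen_projChart k i).fromSpec ∘ PrimeSpectrum.comap φ
  have hf : Topology.IsInducing f :=
    (isAffineOpen_projChart k i).fromSpec.isOpenEmbedding.isInducing.comp
      (PrimeSpectrum.isClosedEmbedding_comap_of_surjective _ φ hφ).isInducing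
  have hfU (x) : f x ∈ (U : Set (Proj (homogeneousSubmodule ι k)))ᶜ := by
    refine fun hx ↦ hPU (Specializes.mem_open ?_ U.isOpen hx)
    refine Specializes.map ((PrimeSpectrum.le_iff_specializes P _).mp ?_)
      (isAffineOpen_projChart k i).fromSpec.continuous
    change P.asIdeal ≤ _
    rw [hP, Ideal.span_singleton_le_iff_mem, PrimeSpectrum.comap_asIdeal, Ideal.mem_comap]
    convert! zero_mem x.asIdeal
    exact Ideal.Quotient.eq_zero_iff_mem.mpr (Ideal.mem_span_singleton_self _)
  have hdim := (hf.codRestrict hfU).topologicalKrullDim_le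
  rw [PrimeSpectrum.topologicalKrullDim_eq_ringKrullDim] at hdim
  have hp' := MvPolynomial.ringKrullDim_quotient_span_prime_add_one
    ((MulEquiv.prime_iff e.symm).mpr hp)
  have hle := (add_le_add_left hdim 2).trans (hU.trans (topologicalKrullDim_proj_le k i))
  rw [← hp', ← one_add_one_eq_two, ← add_assoc, hp'] at hle
  norm_cast at hle
  lia

lemma nonempty_of_codim_two [Finite ι] [Nonempty ι] {U : (Proj (homogeneousSubmodule ι k)).Opens}
    (hU : topologicalKrullDim ((U : Set (Proj (homogeneousSubmodule ι k)))ᶜ : Set _) + 2 ≤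
      topologicalKrullDim (Proj (homogeneousSubmodule ι k))) : Nonempty U := by
  by_contra h
  have hUc : (U : Set (Proj (homogeneousSubmodule ι k)))ᶜ = Set.univ := by
    rw [Set.compl_univ_iff, ← Set.not_nonempty_iff_eq_empty]
    exact fun ⟨x, hx⟩ ↦ h ⟨⟨x, hx⟩⟩
  rw [hUc, IsHomeomorph.topologicalKrullDim_eq _
    (Homeomorph.Set.univ (Proj (homogeneousSubmodule ι k))).isHomeomorph] at hU
  have hle := topologicalKrullDim_proj_le k (Classical.arbitrary ι)
  have : Nonempty (IrreducibleCloseds (Proj (homogeneousSubmodule ι k))) :=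
    ⟨⟨Set.univ, IrreducibleSpace.isIrreducible_univ _, isClosed_univ⟩⟩
  have hnonneg : 0 ≤ topologicalKrullDim (Proj (homogeneousSubmodule ι k)) :=
    Order.krullDim_nonneg
  generalize topologicalKrullDim (Proj (homogeneousSubmodule ι k)) = d at *
  lift d to ℕ∞ using (by rintro rfl; simp at hnonneg)
  lift d to ℕ using 
    (by rintro rfl; exact ENat.natCast_ne_top _ (top_le_iff.mp (WithBot.coe_le_coe.mp hle)))
  have h2 : d + 2 ≤ d := by
    exact_mod_cast (WithBot.coe_le_coe.mp hU : ((d + 2 : ℕ) : ℕ∞) ≤ d)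
  lia

lemma bijective_restriction_proj_of_codim_two [Finite ι]
    {U : (Proj (homogeneousSubmodule ι k)).Opens}
    (hU : topologicalKrullDim ((U : Set (Proj (homogeneousSubmodule ι k)))ᶜ : Set _) + 2 ≤
      topologicalKrullDim (Proj (homogeneousSubmodule ι k))) :
    Function.Bijective
      ((Proj (homogeneousSubmodule ι k)).presheaf.map (homOfLE (le_top : U ≤ ⊤)).op) := by
  by_cases hι : Nonempty ι
  · have := nonempty_of_codim_two k hU
    have (i : ι) : Nonempty (projChart k ι i) := by
      let P : Spec Γ(Proj (homogeneousSubmodule ι k), projChart k ι i) :=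
        Classical.arbitrary (PrimeSpectrum _)
      refine ⟨⟨(isAffineOpen_projChart k i).fromSpec P, ?_⟩⟩
      rw [← SetLike.mem_coe, ← (isAffineOpen_projChart k i).range_fromSpec]
      exact ⟨P, rfl⟩
    exact Scheme.bijective_restriction_of_uniqueFactorizationMonoid (projChart k ι)
      (isAffineOpen_projChart k) (iSup_projChart k ι) inferInstance (mem_of_codim_two k hU)
  · have : U = ⊤ := by
      have := not_nonempty_iff.mp hι
      have h := iSup_projChart k ι
      rw [iSup_of_empty] at h
      exact eq_top_iff.mpr (h.ge.trans bot_le)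
    subst this
    rw [Subsingleton.elim (homOfLE _) (𝟙 (⊤ : (Proj (homogeneousSubmodule ι k)).Opens)), op_id,
      CategoryTheory.Functor.map_id]
    exact Function.bijective_id

end

/-- If the complement of the open set `U ⊆ ℙ(V)` has codimension at least two, then for
any affine `k`-scheme `S` every regular function on `U × S` extends uniquely to
`ℙ(V) × S`: the restriction map `Γ(ℙ(V) × S, O) ⟶ Γ(U × S, O)` is bijective. -/
theorem bijective_restriction_of_codim_two
    (U : (ProjSpace k V).Opens)
    (hcodim : topologicalKrullDim (((U : Set (ProjSpace k V)))ᶜ : Set (ProjSpace k V)) + 2 ≤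
      topologicalKrullDim (ProjSpace k V))
    (S : Scheme) [IsAffine S] (g : S ⟶ Spec (CommRingCat.of k)) :
    Function.Bijective
      ((pullback (ProjSpace.toSpec k V) g).presheaf.map
        (homOfLE (le_top : (pullback.fst (ProjSpace.toSpec k V) g) ⁻¹ᵁ U ≤ ⊤)).op) := by
  have : IsNoetherian (ProjSpace k V) := inferInstanceAs (IsNoetherian (Proj _))
  have : Subsingleton (Spec (CommRingCat.of k)) := inferInstanceAs (Subsingleton (PrimeSpectrum k))
  exact Scheme.bijective_restriction_pullback_of_flat _ g U
    (bijective_restriction_proj_of_codim_two k hcodim)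

end
end
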